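/- arXiv:2412.09882 — 2 statements merged into one kernel-verified Lean document; each statement's English description precedes it below -/
import Mathlib

section
/- Necessary condition from annulus example: let d ≥ 2, E ⊆ [1,2] nonempty, and suppose the maximal operator M_E satisfies ‖M_E f‖_{L^q(ℝ^d)} ≤ C ‖f‖_{L^p(ℝ^d)} for all radial f. Then for every 0 < δ < 1, with N(E, δ) the δ-covering number of E, one has δ^{d−1}·(δ·N(E,δ))^{1/q} ≤ C'·δ^{d/p}. Consequently q ≤ pd (taking E a single point), and if dim_M E = β then (1−β)/q + d − 1 ≥ d/p. -/
open Set MeasureTheory Metric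
open scoped ENNReal NNReal

noncomputable section

/-- Minimal number of (closed) intervals of length `a` needed to cover `E`. -/
def coverNum (E : Set ℝ) (a : ℝ) : ℕ :=
  sInf {n : ℕ | ∃ s : Finset ℝ, s.card = n ∧ E ⊆ ⋃ c ∈ s, Icc c (c + a)}

/-- The upper Minkowski dimension of `E ⊆ [1,2]`. -/
def minkowskiDim (E : Set ℝ) : ℝ :=
  sInf {a : ℝ | 0 < a ∧ ∃ c : ℝ, 0 < c ∧ ∀ δ ∈ Ioo (0 : ℝ) 1,
    (coverNum E δ : ℝ) ≤ c * δ ^ (-a)}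

/-- The normalized surface measure on the unit sphere of `ℝ^d`. -/
def sphMeasure (d : ℕ) : Measure (sphere (0 : EuclideanSpace ℝ (Fin d)) 1) :=
  (((volume : Measure (EuclideanSpace ℝ (Fin d))).toSphere univ)⁻¹) •
    (volume : Measure (EuclideanSpace ℝ (Fin d))).toSphere

/-- Spherical average (of the absolute value) at radius `t`. -/
def sphAvg (d : ℕ) (f : EuclideanSpace ℝ (Fin d) → ℝ) (t : ℝ)
    (x : EuclideanSpace ℝ (Fin d)) : ℝ≥0∞ :=
  ∫⁻ y : sphere (0 : EuclideanSpace ℝ (Fin d)) 1,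
    ENNReal.ofReal |f (x - t • (y : EuclideanSpace ℝ (Fin d)))| ∂(sphMeasure d)

/-- Spherical maximal operator over the dilation set `E`. -/
def sphMax (d : ℕ) (E : Set ℝ) (f : EuclideanSpace ℝ (Fin d) → ℝ)
    (x : EuclideanSpace ℝ (Fin d)) : ℝ≥0∞ :=
  ⨆ t ∈ E, sphAvg d f t x

/-- The `L^p(μ)` norm (finite `p`) of an `ℝ≥0∞`-valued function. -/
def lpE {α : Type*} [MeasurableSpace α] (μ : Measure α) (p : ℝ)
    (g : α → ℝ≥0∞) : ℝ≥0∞ :=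
  (∫⁻ x, g x ^ p ∂μ) ^ (1 / p)

section Helpers

open scoped Pointwise

abbrev Eu (d : ℕ) := EuclideanSpace ℝ (Fin d)

def vB (d : ℕ) : ℝ := (volume (ball (0 : Eu d) 1)).toReal

lemma vB_pos (d : ℕ) : 0 < vB d := by
  unfold vB
  exact ENNReal.toReal_pos (measure_ball_pos _ _ one_pos).ne' measure_ball_lt_top.ne

lemma vB_eq (d : ℕ) : volume (ball (0 : Eu d) 1) = ENNReal.ofReal (vB d) := by
  unfold vB
  rw [ENNReal.ofReal_toReal measure_ball_lt_top.ne]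

lemma vol_ball (d : ℕ) (hd : 2 ≤ d) (x : Eu d) (r : ℝ) (hr : 0 ≤ r) :
    volume (ball x r) = ENNReal.ofReal (r ^ d * vB d) := by
  have : Nonempty (Fin d) := ⟨⟨0, by omega⟩⟩
  rw [Measure.addHaar_ball _ _ hr, vB_eq, finrank_euclideanSpace_fin,
    ENNReal.ofReal_mul (by positivity)]

def ann (d : ℕ) (a b : ℝ) : Set (Eu d) := {x | a ≤ ‖x‖ ∧ ‖x‖ < b}

lemma meas_ann (d : ℕ) (a b : ℝ) : MeasurableSet (ann d a b) :=
  (measurableSet_le measurable_const measurable_norm).inter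
    (measurableSet_lt measurable_norm measurable_const)

lemma vol_ann (d : ℕ) (hd : 2 ≤ d) (a b : ℝ) (ha : 0 ≤ a) (hab : a ≤ b) :
    volume (ann d a b) = ENNReal.ofReal ((b ^ d - a ^ d) * vB d) := by
  have h : ann d a b = ball (0 : Eu d) b \ ball 0 a := by
    ext x
    simp [ann, and_comm]
  rw [h, measure_sdiff (ball_subset_ball hab) measurableSet_ball.nullMeasurableSet
    measure_ball_lt_top.ne, vol_ball d hd _ _ ha, vol_ball d hd _ _ (ha.trans hab), sub_mul,
    ENNReal.ofReal_sub]
  have := vB_pos d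
  positivity

lemma sphMeasure_apply (d : ℕ) (hd : 2 ≤ d) (s : Set (sphere (0 : Eu d) 1))
    (hs : MeasurableSet s) :
    sphMeasure d s = (ENNReal.ofReal (vB d))⁻¹ * volume (Ioo (0 : ℝ) 1 • ((↑) '' s : Set (Eu d))) := by
  unfold sphMeasure
  rw [Measure.smul_apply, Measure.toSphere_apply' _ hs, Measure.toSphere_apply_univ,
    finrank_euclideanSpace_fin, vB_eq, smul_eq_mul, ENNReal.mul_inv (by simp) (by simp)]
  have h1 : (d : ℝ≥0∞)⁻¹ * d = 1 := ENNReal.inv_mul_cancel (by simp; omega) (by simp)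
  calc _ = ((d : ℝ≥0∞)⁻¹ * d) * ((ENNReal.ofReal (vB d))⁻¹ *
        volume (Ioo (0 : ℝ) 1 • ((↑) '' s : Set (Eu d)))) := by ring
    _ = _ := by rw [h1, one_mul]

lemma sphMeasure_univ (d : ℕ) (hd : 2 ≤ d) : sphMeasure d univ = 1 := by
  unfold sphMeasure
  rw [Measure.smul_apply, Measure.toSphere_apply_univ,
    finrank_euclideanSpace_fin, vB_eq, smul_eq_mul, ENNReal.inv_mul_cancel]
  · have := vB_pos d
    simp only [ne_eq, mul_eq_zero, not_or]
    refine ⟨by simp; omega, by simpa using this⟩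
  · exact ENNReal.mul_ne_top (by simp) (by simp)

lemma dir_close {d : ℕ} (e z : Eu d) (he : ‖e‖ = 1) (s ε : ℝ) (hs : 1 / 2 ≤ s)
    (h : ‖z - s • e‖ < ε / 8) (hz : 0 < ‖z‖) : ‖(‖z‖⁻¹) • z - e‖ < ε := by
  have hs0 : 0 < s := by linarith
  have h1 : |‖z‖ - s| ≤ ‖z - s • e‖ := by
    have := abs_norm_sub_norm_le z (s • e)
    rwa [norm_smul, he, mul_one, Real.norm_of_nonneg hs0.le] at this
  have h2 : s • ((‖z‖⁻¹) • z - e) = (z - s • e) - ((‖z‖ - s) * ‖z‖⁻¹) • z := by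
    rw [sub_mul, mul_inv_cancel₀ hz.ne', smul_sub, smul_smul, sub_smul, one_smul]
    abel
  have h3 : s * ‖(‖z‖⁻¹) • z - e‖ ≤ ‖z - s • e‖ + |‖z‖ - s| := by
    calc s * ‖(‖z‖⁻¹) • z - e‖ = ‖s • ((‖z‖⁻¹) • z - e)‖ := by
          rw [norm_smul, Real.norm_of_nonneg hs0.le]
      _ ≤ ‖z - s • e‖ + ‖((‖z‖ - s) * ‖z‖⁻¹) • z‖ := by rw [h2]; exact norm_sub_le _ _
      _ = _ := by
          rw [norm_smul, norm_mul, norm_inv, norm_norm, mul_assoc, inv_mul_cancel₀ hz.ne', mul_one,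
            Real.norm_eq_abs]
  have := norm_nonneg ((‖z‖⁻¹) • z - e)
  nlinarith [norm_nonneg (z - s • e)]

lemma cap_lower (d : ℕ) (hd : 2 ≤ d) (e : Eu d) (he : ‖e‖ = 1) (ε : ℝ) (h0 : 0 < ε) (h1 : ε ≤ 1) :
    ENNReal.ofReal ((2 * 8 ^ d)⁻¹ * ε ^ (d - 1)) ≤
      sphMeasure d {y : sphere (0 : Eu d) 1 | ‖(y : Eu d) - e‖ < ε} := by
  have hv := vB_pos d
  have hmeas : MeasurableSet {y : sphere (0 : Eu d) 1 | ‖(y : Eu d) - e‖ < ε} :=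
    (isOpen_lt (by fun_prop) continuous_const).measurableSet
  rw [sphMeasure_apply d hd _ hmeas]
  set n := ⌊1 / ε⌋₊ with hn
  have hn1 : (n : ℝ) ≤ 1 / ε := Nat.floor_le (by positivity)
  have hn2 : 1 / ε ≤ 2 * n := by
    have ha := Nat.lt_floor_add_one (1 / ε)
    have hb : 1 ≤ n := Nat.le_floor (by rw [Nat.cast_one, le_div_iff₀ h0]; linarith)
    have hb' : (1 : ℝ) ≤ n := by exact_mod_cast hb
    rw [← hn] at ha
    linarith
  have hnε : n * ε ≤ 1 := by rwa [le_div_iff₀ h0] at hn1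
  let c : ℕ → ℝ := fun k => 1 / 2 + k * (ε / 4)
  have hsub : (⋃ k ∈ Finset.range n, ball (c k • e) (ε / 8)) ⊆
      Ioo (0 : ℝ) 1 • ((↑) '' {y : sphere (0 : Eu d) 1 | ‖(y : Eu d) - e‖ < ε} : Set (Eu d)) := by
    intro z hz
    simp only [mem_iUnion, Finset.mem_range, mem_ball, dist_eq_norm] at hz
    obtain ⟨k, hk, hz⟩ := hz
    have hk' : (k : ℝ) ≤ n := by exact_mod_cast hk.le
    have hk0 : (0 : ℝ) ≤ k := by positivity
    have hc1 : 1 / 2 ≤ c k := by simp only [c]; nlinarith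
    have hc2 : c k ≤ 3 / 4 := by simp only [c]; nlinarith
    have ha : |‖z‖ - c k| < ε / 8 := by
      have := abs_norm_sub_norm_le z (c k • e)
      rw [norm_smul, he, mul_one, Real.norm_of_nonneg (by linarith)] at this
      linarith
    rw [abs_lt] at ha
    have hz0 : 0 < ‖z‖ := by linarith
    refine mem_smul.2 ⟨‖z‖, ⟨hz0, by linarith⟩, (‖z‖⁻¹) • z, ⟨⟨(‖z‖⁻¹) • z, ?_⟩, ?_, rfl⟩, ?_⟩
    · rw [mem_sphere_zero_iff_norm, norm_smul, norm_inv, norm_norm, inv_mul_cancel₀ hz0.ne']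
    · exact dir_close e z he (c k) ε hc1 hz hz0
    · simp only [smul_smul, mul_inv_cancel₀ hz0.ne', one_smul]
  have hdisj : PairwiseDisjoint (↑(Finset.range n)) (fun k => ball (c k • e) (ε / 8)) := by
    intro i _ j _ hij
    apply ball_disjoint_ball
    rw [dist_eq_norm, ← sub_smul, norm_smul, he, mul_one, Real.norm_eq_abs]
    have : c i - c j = ((i : ℤ) - (j : ℤ) : ℤ) * (ε / 4) := by simp only [c]; push_cast; ring
    rw [this, abs_mul, abs_of_pos (by positivity : 0 < ε / 4)]
    have h3 : (1 : ℝ) ≤ |(((i : ℤ) - (j : ℤ) : ℤ) : ℝ)| := by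
      have : (1 : ℤ) ≤ |(i : ℤ) - (j : ℤ)| := Int.one_le_abs (by omega)
      exact_mod_cast this
    nlinarith
  have hvol : ENNReal.ofReal (n * ((ε / 8) ^ d * vB d)) ≤
      volume (Ioo (0 : ℝ) 1 •
        ((↑) '' {y : sphere (0 : Eu d) 1 | ‖(y : Eu d) - e‖ < ε} : Set (Eu d))) := by
    refine le_trans (le_of_eq ?_) (measure_mono hsub)
    rw [measure_biUnion_finset hdisj (fun _ _ => measurableSet_ball)]
    simp only [vol_ball d hd _ _ (by positivity : 0 ≤ ε / 8)]
    rw [Finset.sum_const, Finset.card_range, nsmul_eq_mul, ENNReal.ofReal_mul (by positivity),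
      ENNReal.ofReal_natCast]
  refine le_trans ?_ (mul_le_mul_right hvol _)
  rw [← ENNReal.ofReal_inv_of_pos hv, ← ENNReal.ofReal_mul (by positivity)]
  apply ENNReal.ofReal_le_ofReal
  obtain ⟨m, rfl⟩ : ∃ m, d = m + 1 := ⟨d - 1, by omega⟩
  have e1 : (vB (m + 1))⁻¹ * (n * ((ε / 8) ^ (m + 1) * vB (m + 1))) =
      (n * ε) * (ε ^ m * (8 ^ (m + 1))⁻¹) := by
    rw [div_pow]
    field_simp
    ring
  have e2 : 1 / 2 ≤ n * ε := by
    rw [div_le_iff₀ h0] at hn2; linarith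
  rw [e1, Nat.add_sub_cancel]
  calc (2 * 8 ^ (m + 1))⁻¹ * ε ^ m = (1 / 2) * (ε ^ m * (8 ^ (m + 1))⁻¹) := by
        rw [mul_inv]; ring
    _ ≤ _ := by gcongr

lemma sphAvg_indicator_ge (d : ℕ) (S : Set (Eu d)) (t : ℝ) (x : Eu d)
    (A : Set (sphere (0 : Eu d) 1)) (hA : MeasurableSet A)
    (h : ∀ y ∈ A, x - t • (y : Eu d) ∈ S) :
    sphMeasure d A ≤ sphAvg d (S.indicator fun _ => 1) t x := by
  unfold sphAvg
  rw [← lintegral_indicator_one hA]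
  apply lintegral_mono
  intro y
  by_cases hy : y ∈ A
  · simp [hy, h y hy]
  · simp [hy]

lemma lpE_ge {α : Type*} [MeasurableSpace α] (μ : Measure α) (q : ℝ) (hq : 1 ≤ q)
    (g : α → ℝ≥0∞) (U : Set α) (hU : MeasurableSet U) (c : ℝ≥0∞) (h : ∀ x ∈ U, c ≤ g x) :
    c * (μ U) ^ (1 / q) ≤ lpE μ q g := by
  have hq0 : 0 < q := by linarith
  unfold lpE
  have : c ^ q * μ U ≤ ∫⁻ x, g x ^ q ∂μ := by
    rw [← lintegral_indicator_const hU]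
    apply lintegral_mono
    intro x
    by_cases hx : x ∈ U
    · simp only [hx, indicator_of_mem]
      exact ENNReal.rpow_le_rpow (h x hx) hq0.le
    · simp [hx]
  calc c * (μ U) ^ (1 / q) = (c ^ q * μ U) ^ (1 / q) := by
        rw [ENNReal.mul_rpow_of_nonneg _ _ (by positivity), ← ENNReal.rpow_mul,
          mul_one_div_cancel hq0.ne', ENNReal.rpow_one]
    _ ≤ _ := ENNReal.rpow_le_rpow this (by positivity)

lemma lpE_indicator {α : Type*} [MeasurableSpace α] (μ : Measure α) (p : ℝ) (hp : 1 ≤ p)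
    (S : Set α) (hS : MeasurableSet S) :
    lpE μ p (fun x => ENNReal.ofReal |S.indicator (fun _ => (1 : ℝ)) x|) = (μ S) ^ (1 / p) := by
  unfold lpE
  congr 1
  rw [← lintegral_indicator_one hS]
  congr 1
  ext x
  by_cases hx : x ∈ S
  · simp [hx]
  · simp [hx]; linarith

lemma exp_compare (a b K : ℝ) (hK : 0 < K)
    (h : ∀ δ ∈ Ioo (0 : ℝ) 1, δ ^ a ≤ K * δ ^ b) : b ≤ a := by
  by_contra hlt
  push Not at hlt
  have hs : 0 < b - a := by linarith
  set δ : ℝ := (K + 1) ^ (-(1 / (b - a))) with hδ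
  have hδ0 : 0 < δ := by positivity
  have hδ1 : δ < 1 := Real.rpow_lt_one_of_one_lt_of_neg (by linarith) (by
    have : 0 < 1 / (b - a) := by positivity
    linarith)
  have h2 : δ ^ (b - a) = (K + 1)⁻¹ := by
    rw [hδ, ← Real.rpow_mul (by positivity), neg_mul, one_div, inv_mul_cancel₀ hs.ne',
      Real.rpow_neg_one]
  have h3 := h δ ⟨hδ0, hδ1⟩
  have h4 : δ ^ b = δ ^ a * (K + 1)⁻¹ := by
    rw [← h2, ← Real.rpow_add hδ0]; congr 1; ring
  rw [h4] at h3
  have h5 : 0 < δ ^ a := by positivity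
  have h6 : K * (δ ^ a * (K + 1)⁻¹) = δ ^ a * (K / (K + 1)) := by field_simp
  have h7 : K / (K + 1) < 1 := by rw [div_lt_one (by positivity)]; linarith
  nlinarith

/-- The grid cells of side `δ` that meet `E`. -/
lemma cells (E : Set ℝ) (hE : E ⊆ Icc (1 : ℝ) 2) (δ : ℝ) (h0 : 0 < δ) :
    ∃ K : Finset ℕ, coverNum E δ ≤ K.card ∧
      ∀ k ∈ K, ∃ t ∈ E, (k : ℝ) * δ ≤ t ∧ t < (k + 1) * δ := by
  classical
  refine ⟨(Finset.range (⌊2 / δ⌋₊ + 1)).filter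
    (fun k : ℕ => ∃ t ∈ E, (k : ℝ) * δ ≤ t ∧ t < (k + 1) * δ), ?_, ?_⟩
  · set K := (Finset.range (⌊2 / δ⌋₊ + 1)).filter
      (fun k : ℕ => ∃ t ∈ E, (k : ℝ) * δ ≤ t ∧ t < (k + 1) * δ)
    refine le_trans (Nat.sInf_le ⟨K.image (fun k : ℕ => (k : ℝ) * δ), rfl, ?_⟩)
      Finset.card_image_le
    intro t ht
    have h12 := hE ht
    have htp : 0 ≤ t / δ := div_nonneg (by linarith [h12.1]) h0.le
    have ha : (⌊t / δ⌋₊ : ℝ) * δ ≤ t := by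
      rw [← le_div_iff₀ h0]; exact Nat.floor_le htp
    have hb : t < ((⌊t / δ⌋₊ : ℝ) + 1) * δ := by
      rw [← div_lt_iff₀ h0]; exact Nat.lt_floor_add_one _
    simp only [mem_iUnion, Finset.mem_image, exists_prop]
    refine ⟨_, ⟨⌊t / δ⌋₊, ?_, rfl⟩, ha, by linarith⟩
    simp only [K, Finset.mem_filter, Finset.mem_range]
    refine ⟨Nat.lt_succ_of_le (Nat.floor_le_floor ?_), t, ht, ha, hb⟩
    exact div_le_div_of_nonneg_right h12.2 h0.le
  · intro k hk
    exact (Finset.mem_filter.1 hk).2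

lemma coverNum_pos (E : Set ℝ) (hE : E ⊆ Icc (1 : ℝ) 2) (hne : E.Nonempty) (δ : ℝ) (h0 : 0 < δ) :
    1 ≤ coverNum E δ := by
  have hex : {n : ℕ | ∃ s : Finset ℝ, s.card = n ∧ E ⊆ ⋃ c ∈ s, Icc c (c + δ)}.Nonempty := by
    classical
    refine ⟨_, (Finset.range (⌊2 / δ⌋₊ + 1)).image (fun k : ℕ => (k : ℝ) * δ), rfl, ?_⟩
    intro t ht
    have h12 := hE ht
    have htp : 0 ≤ t / δ := div_nonneg (by linarith [h12.1]) h0.le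
    have ha : (⌊t / δ⌋₊ : ℝ) * δ ≤ t := by
      rw [← le_div_iff₀ h0]; exact Nat.floor_le htp
    have hb : t < ((⌊t / δ⌋₊ : ℝ) + 1) * δ := by
      rw [← div_lt_iff₀ h0]; exact Nat.lt_floor_add_one _
    simp only [mem_iUnion, Finset.mem_image, exists_prop]
    refine ⟨_, ⟨⌊t / δ⌋₊, ?_, rfl⟩, ha, by linarith⟩
    simp only [Finset.mem_range]
    refine Nat.lt_succ_of_le (Nat.floor_le_floor ?_)
    exact div_le_div_of_nonneg_right h12.2 h0.le
  obtain ⟨s, hs, hcov⟩ := Nat.sInf_mem hex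
  rw [Nat.one_le_iff_ne_zero]
  intro h
  unfold coverNum at h
  rw [h, Finset.card_eq_zero] at hs
  subst hs
  obtain ⟨t, ht⟩ := hne
  simpa using hcov ht

lemma pow_diff_ge (d : ℕ) (hd : 2 ≤ d) (a b : ℝ) (ha : 0 ≤ a) (hab : a ≤ b) (hb : 1 ≤ b) :
    b - a ≤ b ^ d - a ^ d := by
  obtain ⟨m, rfl⟩ : ∃ m, d = m + 1 := ⟨d - 1, by omega⟩
  have h1 : a ^ m ≤ b ^ m := pow_le_pow_left₀ ha hab m
  have h2 : 1 ≤ b ^ m := one_le_pow₀ hb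
  rw [pow_succ, pow_succ]
  nlinarith

lemma part_one_key (d : ℕ) (hd : 2 ≤ d) (E : Set ℝ) (hE : E ⊆ Icc (1 : ℝ) 2) (δ : ℝ)
    (hδ : δ ∈ Ioo (0 : ℝ) 1) (q : ℝ) (hq : 1 ≤ q) :
    ENNReal.ofReal ((2 * 8 ^ d)⁻¹ * (δ / 2) ^ (d - 1) *
      (δ * coverNum E δ * vB d) ^ (1 / q)) ≤
    lpE volume q (sphMax d E ((ball (0 : Eu d) (2 * δ)).indicator fun _ => 1)) := by
  obtain ⟨h0, h1⟩ := hδ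
  have hv := vB_pos d
  obtain ⟨K, hK, hKt⟩ := cells E hE δ h0
  let U : Set (Eu d) := ⋃ k ∈ K, ann d (k * δ) ((k + 1) * δ)
  have hUm : MeasurableSet U := Finset.measurableSet_biUnion _ (fun _ _ => meas_ann _ _ _)
  have hdisj : PairwiseDisjoint (↑K) (fun k : ℕ => ann d (k * δ) ((k + 1) * δ)) := by
    have key : ∀ i j : ℕ, ∀ x ∈ ann d (i * δ) ((i + 1) * δ), x ∈ ann d (j * δ) ((j + 1) * δ) →
        i ≤ j := by
      intro i j x hi hj
      have : (i : ℝ) * δ < (j + 1) * δ := hi.1.trans_lt hj.2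
      have := lt_of_mul_lt_mul_right this h0.le
      have : i < j + 1 := by exact_mod_cast this
      omega
    intro i _ j _ hij
    refine Set.disjoint_left.2 fun x hi hj => hij ?_
    exact le_antisymm (key i j x hi hj) (key j i x hj hi)
  have hUv : ENNReal.ofReal (δ * coverNum E δ * vB d) ≤ volume U := by
    rw [measure_biUnion_finset hdisj (fun _ _ => meas_ann _ _ _)]
    calc ENNReal.ofReal (δ * coverNum E δ * vB d) ≤ ENNReal.ofReal (K.card * (δ * vB d)) := by
          apply ENNReal.ofReal_le_ofReal
          have : (coverNum E δ : ℝ) ≤ K.card := by exact_mod_cast hK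
          calc δ * coverNum E δ * vB d = coverNum E δ * (δ * vB d) := by ring
            _ ≤ _ := by gcongr
      _ = ∑ k ∈ K, ENNReal.ofReal (δ * vB d) := by
          rw [Finset.sum_const, nsmul_eq_mul, ENNReal.ofReal_mul (by positivity),
            ENNReal.ofReal_natCast]
      _ ≤ _ := by
          apply Finset.sum_le_sum
          intro k hk
          obtain ⟨t, ht, hk1, hk2⟩ := hKt k hk
          have := (hE ht).1
          rw [vol_ann d hd _ _ (by positivity) (by linarith)]
          apply ENNReal.ofReal_le_ofReal
          have := pow_diff_ge d hd (k * δ) ((k + 1) * δ) (by positivity) (by linarith) (by linarith)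
          have h3 : δ ≤ ((k + 1) * δ) ^ d - (k * δ) ^ d := by linarith
          gcongr
  have hlow : ∀ x ∈ U, ENNReal.ofReal ((2 * 8 ^ d)⁻¹ * (δ / 2) ^ (d - 1)) ≤
      sphMax d E ((ball (0 : Eu d) (2 * δ)).indicator fun _ => 1) x := by
    intro x hx
    simp only [U, mem_iUnion, exists_prop] at hx
    obtain ⟨k, hk, hx1, hx2⟩ := hx
    obtain ⟨t, ht, hk1, hk2⟩ := hKt k hk
    have ht12 := hE ht
    have hxt : |‖x‖ - t| ≤ δ := by rw [abs_le]; constructor <;> linarith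
    refine le_trans ?_ (le_iSup₂_of_le t ht le_rfl)
    have hx0 : 0 < ‖x‖ := by
      have := (abs_le.1 hxt).1
      linarith [ht12.1]
    have he : ‖(‖x‖⁻¹) • x‖ = 1 := by
      rw [norm_smul, norm_inv, norm_norm, inv_mul_cancel₀ hx0.ne']
    refine le_trans (cap_lower d hd ((‖x‖⁻¹) • x) he (δ / 2) (by linarith) (by linarith)) ?_
    apply sphAvg_indicator_ge
    · exact (isOpen_lt (by fun_prop) continuous_const).measurableSet
    · intro y hy
      simp only [mem_ofPred_eq] at hy
      rw [mem_ball_zero_iff]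
      have hdec : x - t • (y : Eu d) = (‖x‖ - t) • ((‖x‖⁻¹) • x) - t • ((y : Eu d) - (‖x‖⁻¹) • x) := by
        have : x = ‖x‖ • ((‖x‖⁻¹) • x) := by rw [smul_smul, mul_inv_cancel₀ hx0.ne', one_smul]
        nth_rw 1 [this]
        rw [smul_sub, sub_smul]
        abel
      rw [hdec]
      refine (norm_sub_le _ _).trans_lt ?_
      rw [norm_smul (‖x‖ - t), norm_smul t, he, mul_one, Real.norm_eq_abs, Real.norm_eq_abs,
        abs_of_nonneg (by linarith [ht12.1] : 0 ≤ t)]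
      have := norm_nonneg ((y : Eu d) - (‖x‖⁻¹) • x)
      nlinarith [ht12.1, ht12.2]
  refine le_trans ?_ (lpE_ge volume q hq _ U hUm _ hlow)
  rw [ENNReal.ofReal_mul (by positivity), ← ENNReal.ofReal_rpow_of_nonneg (by positivity)
    (by positivity)]
  gcongr

lemma part_one (d : ℕ) (hd : 2 ≤ d) (E : Set ℝ)
    (hE : E ⊆ Icc (1 : ℝ) 2) (p q : ℝ) (hp : 1 ≤ p) (hq : 1 ≤ q)
    (C : ℝ≥0)
    (hbound : ∀ f : EuclideanSpace ℝ (Fin d) → ℝ, Measurable f →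
      (∀ x y, ‖x‖ = ‖y‖ → f x = f y) →
      lpE (volume : Measure (EuclideanSpace ℝ (Fin d))) q (sphMax d E f) ≤
        C * lpE (volume : Measure (EuclideanSpace ℝ (Fin d))) p
          (fun x => ENNReal.ofReal |f x|)) :
    ∃ C' : ℝ, 0 < C' ∧ ∀ δ ∈ Ioo (0 : ℝ) 1,
      δ ^ (d - 1 : ℝ) * (δ * coverNum E δ) ^ (1 / q) ≤ C' * δ ^ ((d : ℝ) / p) := by
  have hv := vB_pos d
  set A : ℝ := (2 * 8 ^ d)⁻¹ * (1 / 2) ^ (d - 1) * vB d ^ (1 / q) with hA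
  set B : ℝ := C * (2 ^ d * vB d) ^ (1 / p) with hB
  have hA0 : 0 < A := by positivity
  have hB0 : 0 ≤ B := by positivity
  refine ⟨(B + 1) / A, by positivity, ?_⟩
  intro δ hδ
  have h0 := hδ.1
  have hk := part_one_key d hd E hE δ hδ q hq
  have hb := hbound ((ball (0 : Eu d) (2 * δ)).indicator fun _ => 1)
    (measurable_const.indicator measurableSet_ball) (by
      intro x y hxy
      simp only [indicator, mem_ball_zero_iff, hxy])
  rw [lpE_indicator _ _ hp _ measurableSet_ball, vol_ball d hd _ _ (by positivity)] at hb
  have h := hk.trans hb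
  rw [ENNReal.ofReal_rpow_of_nonneg (by positivity) (by positivity), ← ENNReal.ofReal_coe_nnreal,
    ← ENNReal.ofReal_mul (by positivity), ENNReal.ofReal_le_ofReal_iff (by positivity)] at h
  have e1 : δ ^ (d - 1 : ℝ) = δ ^ (d - 1) := by
    rw [← Real.rpow_natCast, Nat.cast_sub (by omega), Nat.cast_one]
  have e2 : (2 * 8 ^ d : ℝ)⁻¹ * (δ / 2) ^ (d - 1) * (δ * coverNum E δ * vB d) ^ (1 / q) =
      A * (δ ^ (d - 1) * (δ * coverNum E δ) ^ (1 / q)) := by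
    rw [Real.mul_rpow (by positivity) hv.le, hA, div_eq_mul_one_div δ 2, mul_pow]
    ring
  have e3 : (C : ℝ) * ((2 * δ) ^ d * vB d) ^ (1 / p) = B * δ ^ ((d : ℝ) / p) := by
    have : (2 * δ) ^ d * vB d = (2 ^ d * vB d) * δ ^ d := by rw [mul_pow]; ring
    rw [this, Real.mul_rpow (by positivity) (by positivity), hB, ← Real.rpow_natCast δ d,
      ← Real.rpow_mul h0.le, mul_one_div]
    ring
  rw [e2, e3] at h
  rw [e1, div_mul_eq_mul_div, le_div_iff₀ hA0]
  have : 0 < δ ^ ((d : ℝ) / p) := by positivity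
  nlinarith

lemma part_two (d : ℕ) (hd : 2 ≤ d) (E : Set ℝ)
    (hE : E ⊆ Icc (1 : ℝ) 2) (hne : E.Nonempty) (p q : ℝ) (hp : 1 ≤ p) (hq : 1 ≤ q)
    (C : ℝ≥0)
    (hbound : ∀ f : EuclideanSpace ℝ (Fin d) → ℝ, Measurable f →
      (∀ x y, ‖x‖ = ‖y‖ → f x = f y) →
      lpE (volume : Measure (EuclideanSpace ℝ (Fin d))) q (sphMax d E f) ≤
        C * lpE (volume : Measure (EuclideanSpace ℝ (Fin d))) p
          (fun x => ENNReal.ofReal |f x|)) :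
    q ≤ p * d := by
  have hv := vB_pos d
  have hp0 : 0 < p := by linarith
  have hq0 : 0 < q := by linarith
  obtain ⟨t, ht⟩ := hne
  have ht12 := hE ht
  set A : ℝ := vB d ^ (1 / q) with hA
  set B : ℝ := C * (2 * d * 3 ^ (d - 1) * vB d) ^ (1 / p) with hB
  have hA0 : 0 < A := by positivity
  have hB0 : 0 ≤ B := by positivity
  have hmain : 1 / p ≤ d / q := by
    apply exp_compare _ _ ((B + 1) / A) (by positivity)
    intro δ hδ
    obtain ⟨h0, h1⟩ := hδ
    have hb := hbound ((ann d (t - δ) (t + δ)).indicator fun _ => 1)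
      (measurable_const.indicator (meas_ann _ _ _)) (by
        intro x y hxy
        have hiff : x ∈ ann d (t - δ) (t + δ) ↔ y ∈ ann d (t - δ) (t + δ) := by
          simp only [ann, mem_ofPred_eq, hxy]
        by_cases hy : y ∈ ann d (t - δ) (t + δ)
        · rw [indicator_of_mem hy, indicator_of_mem (hiff.2 hy)]
        · rw [indicator_of_notMem hy, indicator_of_notMem (fun hx => hy (hiff.1 hx))])
    have hlow : ∀ x ∈ ball (0 : Eu d) δ, 1 ≤
        sphMax d E ((ann d (t - δ) (t + δ)).indicator fun _ => 1) x := by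
      intro x hx
      rw [mem_ball_zero_iff] at hx
      refine le_trans ?_ (le_iSup₂_of_le t ht le_rfl)
      rw [← sphMeasure_univ d hd]
      apply sphAvg_indicator_ge _ _ _ _ _ MeasurableSet.univ
      intro y _
      have hy : ‖t • (y : Eu d)‖ = t := by
        rw [norm_smul, norm_eq_of_mem_sphere y, mul_one, Real.norm_of_nonneg (by linarith [ht12.1])]
      have h3 := norm_sub_le x (t • (y : Eu d))
      have h4 := norm_sub_norm_le (t • (y : Eu d)) x
      rw [norm_sub_rev] at h4
      rw [hy] at h3 h4
      exact ⟨by linarith, by linarith⟩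
    have hk := lpE_ge volume q hq _ _ measurableSet_ball 1 hlow
    have h := hk.trans hb
    rw [lpE_indicator _ _ hp _ (meas_ann _ _ _), vol_ball d hd _ _ h0.le,
      vol_ann d hd _ _ (by linarith [ht12.1]) (by linarith), one_mul] at h
    have hpow : (t + δ) ^ d - (t - δ) ^ d ≤ 2 * d * 3 ^ (d - 1) * δ := by
      have h5 := (le_abs_self _).trans (abs_pow_sub_pow_le (t + δ) (t - δ) d)
      rw [abs_of_nonneg (by linarith : 0 ≤ t + δ - (t - δ)),
        abs_of_nonneg (by linarith [ht12.1] : 0 ≤ t + δ),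
        abs_of_nonneg (by linarith [ht12.1] : 0 ≤ t - δ), max_eq_left (by linarith)] at h5
      refine h5.trans ?_
      have h6 : (t + δ) ^ (d - 1) ≤ 3 ^ (d - 1) :=
        pow_le_pow_left₀ (by linarith [ht12.1]) (by linarith [ht12.2]) _
      calc (t + δ - (t - δ)) * d * (t + δ) ^ (d - 1) = 2 * d * δ * (t + δ) ^ (d - 1) := by ring
        _ ≤ 2 * d * δ * 3 ^ (d - 1) := by gcongr
        _ = _ := by ring
    have hpow' : ((t + δ) ^ d - (t - δ) ^ d) * vB d ≤ (2 * d * 3 ^ (d - 1) * vB d) * δ := by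
      calc _ ≤ (2 * d * 3 ^ (d - 1) * δ) * vB d := by gcongr
        _ = _ := by ring
    have h := h.trans (mul_le_mul_right (ENNReal.rpow_le_rpow (ENNReal.ofReal_le_ofReal hpow')
      (by positivity : 0 ≤ 1 / p)) _)
    rw [ENNReal.ofReal_rpow_of_nonneg (by positivity) (by positivity),
      ENNReal.ofReal_rpow_of_nonneg (by positivity) (by positivity), ← ENNReal.ofReal_coe_nnreal,
      ← ENNReal.ofReal_mul (by positivity), ENNReal.ofReal_le_ofReal_iff (by positivity),
      Real.mul_rpow (by positivity) (by positivity), Real.mul_rpow (by positivity) (by positivity),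
      ← Real.rpow_natCast δ d, ← Real.rpow_mul h0.le, mul_one_div, ← mul_assoc] at h
    rw [div_mul_eq_mul_div, le_div_iff₀ hA0]
    have : 0 < δ ^ (1 / p) := by positivity
    nlinarith
  rw [div_le_div_iff₀ hp0 hq0] at hmain
  linarith

lemma part_three (d : ℕ) (E : Set ℝ) (hE : E ⊆ Icc (1 : ℝ) 2) (hne : E.Nonempty) (p q : ℝ)
    (hq : 1 ≤ q)
    (h : ∃ C' : ℝ, 0 < C' ∧ ∀ δ ∈ Ioo (0 : ℝ) 1,
      δ ^ (d - 1 : ℝ) * (δ * coverNum E δ) ^ (1 / q) ≤ C' * δ ^ ((d : ℝ) / p)) :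
    (1 - minkowskiDim E) / q + d - 1 ≥ d / p := by
  have hq0 : 0 < q := by linarith
  obtain ⟨C', hC, h⟩ := h
  set a : ℝ := 1 - q * (d / p - (d - 1)) with ha
  have hN : ∀ δ ∈ Ioo (0 : ℝ) 1, (coverNum E δ : ℝ) ≤ C' ^ q * δ ^ (-a) := by
    intro δ hδ
    have h0 := hδ.1
    have h1 := h δ hδ
    have h2 : (δ * coverNum E δ) ^ (1 / q) ≤ C' * δ ^ ((d : ℝ) / p - (d - 1)) := by
      rw [Real.rpow_sub h0, mul_div_assoc', le_div_iff₀ (by positivity)]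
      linarith
    have h3 := Real.rpow_le_rpow (by positivity) h2 hq0.le
    rw [← Real.rpow_mul (by positivity), one_div_mul_cancel hq0.ne', Real.rpow_one,
      Real.mul_rpow hC.le (by positivity), ← Real.rpow_mul h0.le] at h3
    have e : δ ^ (-a) = δ ^ (((d : ℝ) / p - (d - 1)) * q) / δ := by
      rw [← Real.rpow_sub_one h0.ne']; congr 1; rw [ha]; ring
    rw [e, mul_div_assoc', le_div_iff₀ h0]
    linarith
  have ha0 : 0 ≤ a := by
    have := exp_compare 0 (-a) (C' ^ q) (by positivity) (by
      intro δ hδ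
      rw [Real.rpow_zero]
      refine le_trans ?_ (hN δ hδ)
      exact_mod_cast coverNum_pos E hE hne δ hδ.1)
    linarith
  have hβ : minkowskiDim E ≤ a := by
    apply le_of_forall_pos_le_add
    intro ε hε
    apply csInf_le ⟨0, fun x hx => hx.1.le⟩
    refine ⟨by linarith, C' ^ q, by positivity, fun δ hδ => (hN δ hδ).trans ?_⟩
    have : δ ^ (-a) ≤ δ ^ (-(a + ε)) :=
      Real.rpow_le_rpow_of_exponent_ge hδ.1 hδ.2.le (by linarith)
    gcongr
  have h5 : (d : ℝ) / p - (d - 1) ≤ (1 - minkowskiDim E) / q := by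
    rw [le_div_iff₀ hq0]
    linarith
  linarith

end Helpers

theorem annulus_necessary_condition (d : ℕ) (hd : 2 ≤ d) (E : Set ℝ)
    (hE : E ⊆ Icc (1 : ℝ) 2) (hne : E.Nonempty) (p q : ℝ) (hp : 1 ≤ p) (hq : 1 ≤ q)
    (C : ℝ≥0)
    (hbound : ∀ f : EuclideanSpace ℝ (Fin d) → ℝ, Measurable f →
      (∀ x y, ‖x‖ = ‖y‖ → f x = f y) →
      lpE (volume : Measure (EuclideanSpace ℝ (Fin d))) q (sphMax d E f) ≤
        C * lpE (volume : Measure (EuclideanSpace ℝ (Fin d))) p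
          (fun x => ENNReal.ofReal |f x|)) :
    (∃ C' : ℝ, 0 < C' ∧ ∀ δ ∈ Ioo (0 : ℝ) 1,
      δ ^ (d - 1 : ℝ) * (δ * coverNum E δ) ^ (1 / q) ≤ C' * δ ^ ((d : ℝ) / p)) ∧
    q ≤ p * d ∧
    (∀ β : ℝ, β = minkowskiDim E → (1 - β) / q + d - 1 ≥ d / p) := by
  have h1 := part_one d hd E hE p q hp hq C hbound
  refine ⟨h1, part_two d hd E hE hne p q hp hq C hbound, ?_⟩
  rintro β rfl
  exact part_three d E hE hne p q hq h1
end
end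

section
/- Logarithmic endpoint necessary condition: let d ≥ 2, p_d = d/(d−1), and E ⊆ [1,2]. For n ≫ 1, the radial function f(x) = |x|^{1−d}·χ_{[2^{−10n}, 1]}(|x|) satisfies ‖f‖_{L^{p_d}(ℝ^d)} ∼ n^{1/p_d}, and M_E f(x) ≥ c·n whenever dist(|x|, E) ≤ 2^{−n+1}. Consequently, if M_E is bounded from L^{p_d}_{rad}(ℝ^d) to L^q(ℝ^d), then |W_n(E)| ≤ C·n^{−q/d} for all n ≥ 1, and hence sup_{0<δ<1} (log(1/δ))^{q/d}·δ·N(E,δ) < ∞. -/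
open Set MeasureTheory Metric
open scoped ENNReal NNReal

noncomputable section

/-- The `2^{-n+1}`-neighborhood of `E` inside `[0,∞)`. -/
def Wn (E : Set ℝ) (n : ℕ) : Set ℝ :=
  {r : ℝ | 0 ≤ r ∧ Metric.infDist r E ≤ 2 ^ (-(n : ℤ) + 1)}

/-- The test function `f(x) = |x|^{1−d} χ_{[2^{−10n},1]}(|x|)`. -/
def testFn (d n : ℕ) (x : EuclideanSpace ℝ (Fin d)) : ℝ :=
  if (2 : ℝ) ^ (-(10 * n : ℤ)) ≤ ‖x‖ ∧ ‖x‖ ≤ 1 then ‖x‖ ^ (1 - (d : ℝ)) else 0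

/-- The volume of `{x | ‖x‖ ∈ ...}` type integrals in polar coordinates. -/
lemma polar_lintegral (d : ℕ) (hd : 2 ≤ d) (g : ℝ → ℝ≥0∞) (hg : Measurable g) :
    ∫⁻ x : EuclideanSpace ℝ (Fin d), g ‖x‖ =
      (volume : Measure (EuclideanSpace ℝ (Fin d))).toSphere univ *
        ∫⁻ r in Ioi (0 : ℝ), ENNReal.ofReal (r ^ (d - 1)) * g r := by
  have : Nonempty (Fin d) := ⟨⟨0, by omega⟩⟩
  let μ : Measure (EuclideanSpace ℝ (Fin d)) := volume
  calc ∫⁻ x, g ‖x‖ ∂μ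
      = ∫⁻ x : ({(0)}ᶜ : Set (EuclideanSpace ℝ (Fin d))), g (‖x.1‖) ∂(μ.comap (↑)) := by
        rw [lintegral_subtype_comap (measurableSet_singleton _).compl fun x ↦ g (‖x‖),
          restrict_compl_singleton]
    _ = ∫⁻ x, g x.2 ∂μ.toSphere.prod (.volumeIoiPow (d - 1)) := by
      have := μ.measurePreserving_homeomorphUnitSphereProd.lintegral_comp
        (f := fun z => g z.2) (by fun_prop)
      simpa using this
    _ = μ.toSphere univ * ∫⁻ x : Ioi (0 : ℝ), g x ∂.volumeIoiPow (d - 1) := by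
      rw [lintegral_prod _ (by fun_prop)]
      simp [mul_comm]
    _ = _ := by
      congr 1
      rw [Measure.volumeIoiPow, lintegral_withDensity_eq_lintegral_mul _ (by fun_prop) (by fun_prop)]
      rw [← lintegral_subtype_comap measurableSet_Ioi]
      rfl

lemma cap_aux (d : ℕ) (hd : 2 ≤ d) (y : sphere (0 : EuclideanSpace ℝ (Fin d)) 1) (ρ : ℝ)
    (h0 : 0 < ρ) (h1 : ρ ≤ 1 / 2) :
    (volume : Measure (EuclideanSpace ℝ (Fin d))) (ball 0 1) * ENNReal.ofReal (ρ ^ d) ≤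
      (volume : Measure (EuclideanSpace ℝ (Fin d))).toSphere (ball y (2 * ρ)) *
        ENNReal.ofReal (2 ^ (d - 1) * (2 * ρ)) := by
  have : Nonempty (Fin d) := ⟨⟨0, by omega⟩⟩
  let μ : Measure (EuclideanSpace ℝ (Fin d)) := volume
  let I : Set (Ioi (0 : ℝ)) := {r | r.1 ∈ Ioo (1 - ρ) (1 + ρ)}
  have hI : MeasurableSet I := measurable_subtype_coe measurableSet_Ioo
  have hvol : Measure.volumeIoiPow (d - 1) I ≤ ENNReal.ofReal (2 ^ (d - 1) * (2 * ρ)) := by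
    rw [Measure.volumeIoiPow, withDensity_apply _ hI]
    calc _ ≤ ∫⁻ r in I, ENNReal.ofReal (2 ^ (d - 1)) ∂(Measure.comap Subtype.val volume) := by
          refine setLIntegral_mono measurable_const fun r hr => ?_
          have h2 : r.1 < 1 + ρ := hr.2
          have h3 : 0 < r.1 := r.2
          gcongr
          linarith
      _ = ENNReal.ofReal (2 ^ (d - 1)) * (Measure.comap Subtype.val volume) I := by
          simp
      _ ≤ ENNReal.ofReal (2 ^ (d - 1)) * ENNReal.ofReal (2 * ρ) := by
          gcongr
          rw [comap_subtype_coe_apply measurableSet_Ioi]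
          calc volume (Subtype.val '' I) ≤ volume (Ioo (1 - ρ) (1 + ρ)) := by
                apply measure_mono
                rintro _ ⟨r, hr, rfl⟩
                exact hr
            _ = _ := by rw [Real.volume_Ioo]; congr 1; ring
      _ = _ := by rw [← ENNReal.ofReal_mul (by positivity)]
  calc μ (ball 0 1) * ENNReal.ofReal (ρ ^ d) = μ (ball y ρ) := by
        rw [Measure.addHaar_ball μ _ h0.le, mul_comm]; simp
    _ = (μ.comap Subtype.val) {z : ({(0)}ᶜ : Set (EuclideanSpace ℝ (Fin d))) | z.1 ∈ ball (y : EuclideanSpace ℝ (Fin d)) ρ} := by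
        rw [comap_subtype_coe_apply (measurableSet_singleton _).compl]
        congr 1
        ext z
        simp only [mem_image, Subtype.exists, mem_ofPred_eq, exists_and_left, exists_prop, exists_eq_right_right]
        refine ⟨fun h => ⟨h, ?_⟩, fun h => h.1⟩
        rintro rfl
        have : dist (0 : EuclideanSpace ℝ (Fin d)) y = 1 := by simp
        rw [mem_ball, this] at h
        linarith
    _ ≤ (μ.comap Subtype.val) ((homeomorphUnitSphereProd _) ⁻¹' ((ball y (2 * ρ)) ×ˢ I)) := by
        apply measure_mono
        intro z hz
        have hz : dist z.1 (y : EuclideanSpace ℝ (Fin d)) < ρ := hz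
        have hz0 : 0 < ‖z.1‖ := norm_pos_iff.2 z.2
        have hy : ‖(y : EuclideanSpace ℝ (Fin d))‖ = 1 := by simp
        have hn : |‖z.1‖ - 1| < ρ := by
          rw [← hy]
          refine (abs_norm_sub_norm_le _ _).trans_lt ?_
          rwa [← dist_eq_norm]
        rw [abs_lt] at hn
        refine ⟨?_, ?_⟩
        · rw [mem_ball, Subtype.dist_eq]
          simp only [homeomorphUnitSphereProd_apply_fst_coe]
          have h1 : dist (‖z.1‖⁻¹ • z.1) z.1 < ρ := by
            have : ‖z.1‖⁻¹ • z.1 - z.1 = (‖z.1‖⁻¹ - 1) • z.1 := by rw [sub_smul, one_smul]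
            rw [dist_eq_norm, this, norm_smul, Real.norm_eq_abs, ← abs_of_pos hz0, ← abs_mul,
              abs_of_pos hz0, sub_mul, inv_mul_cancel₀ hz0.ne', abs_lt]
            constructor <;> linarith
          linarith [dist_triangle (‖z.1‖⁻¹ • z.1) z.1 y]
        · change (homeomorphUnitSphereProd _ z).2.1 ∈ Ioo (1 - ρ) (1 + ρ)
          simp only [homeomorphUnitSphereProd_apply_snd_coe]
          constructor <;> linarith
    _ = μ.toSphere (ball y (2 * ρ)) * Measure.volumeIoiPow (d - 1) I := by
        rw [μ.measurePreserving_homeomorphUnitSphereProd.measure_preimage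
          (measurableSet_ball.prod hI).nullMeasurableSet, Measure.prod_prod]
        simp
    _ ≤ _ := by gcongr

lemma toSphere_fin (d : ℕ) (hd : 2 ≤ d) : ∃ w : ℝ, 0 < w ∧
    (volume : Measure (EuclideanSpace ℝ (Fin d))).toSphere univ = ENNReal.ofReal w := by
  have : Nonempty (Fin d) := ⟨⟨0, by omega⟩⟩
  have h1 : (volume : Measure (EuclideanSpace ℝ (Fin d))).toSphere univ ≠ ⊤ := measure_ne_top _ _
  have h0 : (volume : Measure (EuclideanSpace ℝ (Fin d))).toSphere univ ≠ 0 := by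
    rw [Ne, Measure.measure_univ_eq_zero]
    exact Measure.toSphere_ne_zero _
  exact ⟨_, ENNReal.toReal_pos h0 h1, (ENNReal.ofReal_toReal h1).symm⟩

lemma cap_lower_s18 (d : ℕ) (hd : 2 ≤ d) : ∃ K : ℝ, 0 < K ∧
    ∀ (y : sphere (0 : EuclideanSpace ℝ (Fin d)) 1) (ρ : ℝ), 0 < ρ → ρ ≤ 1 / 2 →
      ENNReal.ofReal (K * ρ ^ (d - 1)) ≤ sphMeasure d (ball y (2 * ρ)) := by
  have : Nonempty (Fin d) := ⟨⟨0, by omega⟩⟩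
  obtain ⟨w, hw, hw'⟩ := toSphere_fin d hd
  set v := (volume (ball (0 : EuclideanSpace ℝ (Fin d)) 1)).toReal with hv
  have hvt : volume (ball (0 : EuclideanSpace ℝ (Fin d)) 1) ≠ ⊤ := measure_ball_lt_top.ne
  have hv0 : 0 < v := ENNReal.toReal_pos (measure_ball_pos _ _ one_pos).ne' hvt
  refine ⟨w⁻¹ * (v / 2 ^ d), by positivity, fun y ρ h0 h1 => ?_⟩
  have h := cap_aux d hd y ρ h0 h1
  set T := (volume : Measure (EuclideanSpace ℝ (Fin d))).toSphere (ball y (2 * ρ)) with hT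
  have hTt : T ≠ ⊤ := measure_ne_top _ _
  rw [← ENNReal.ofReal_toReal hvt, ← ENNReal.ofReal_toReal hTt, ← ENNReal.ofReal_mul (by positivity),
    ← ENNReal.ofReal_mul (by positivity), ENNReal.ofReal_le_ofReal_iff (by positivity), ← hv] at h
  rw [sphMeasure, Measure.smul_apply, smul_eq_mul, ← hT, hw', ← ENNReal.ofReal_inv_of_pos hw,
    ← ENNReal.ofReal_toReal hTt, ← ENNReal.ofReal_mul (by positivity)]
  apply ENNReal.ofReal_le_ofReal
  obtain ⟨k, rfl⟩ : ∃ k, d = k + 1 := ⟨d - 1, by omega⟩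
  simp only [Nat.add_sub_cancel] at *
  rw [mul_assoc]
  gcongr
  have : v * ρ ^ k ≤ T.toReal * 2 ^ (k + 1) := by
    have h2 : (v * ρ ^ k) * ρ ≤ (T.toReal * 2 ^ (k + 1)) * ρ := by
      calc _ = v * ρ ^ (k + 1) := by ring
        _ ≤ _ := h
        _ = _ := by ring
    exact le_of_mul_le_mul_right h2 h0
  rw [div_mul_eq_mul_div, div_le_iff₀ (by positivity)]
  exact this

lemma annulus_lower (d : ℕ) (hd : 2 ≤ d) : ∃ K : ℝ, 0 < K ∧
    ∀ (e : sphere (0 : EuclideanSpace ℝ (Fin d)) 1) (r : ℝ), 0 < r → r ≤ 1 →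
      ENNReal.ofReal (K * r ^ (d - 1)) ≤ sphMeasure d {y | r ≤ dist y e ∧ dist y e < 2 * r} := by
  obtain ⟨K, hK, h⟩ := cap_lower_s18 d hd
  refine ⟨K * (1 / 4) ^ (d - 1), by positivity, fun e r h0 h1 => ?_⟩
  have hrank : 1 < Module.rank ℝ (EuclideanSpace ℝ (Fin d)) := by
    rw [← Module.finrank_eq_rank]
    simp only [finrank_euclideanSpace, Fintype.card_fin]
    exact_mod_cast hd
  have hpre := isPreconnected_sphere hrank (0 : EuclideanSpace ℝ (Fin d)) 1
  have hneg : -(e : EuclideanSpace ℝ (Fin d)) ∈ sphere (0 : EuclideanSpace ℝ (Fin d)) 1 := by simp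
  have hiv := hpre.intermediate_value e.2 hneg
    (f := fun y => dist y (e : EuclideanSpace ℝ (Fin d))) (by fun_prop)
  have hd2 : dist (-(e : EuclideanSpace ℝ (Fin d))) e = 2 := by
    rw [dist_eq_norm, ← neg_add', norm_neg, ← two_smul ℝ, norm_smul]; simp
  simp only [dist_self, hd2] at hiv
  obtain ⟨y, hy, hye⟩ := hiv (show (3 / 2 * r) ∈ Icc (0 : ℝ) 2 from ⟨by positivity, by linarith⟩)
  refine le_trans ?_ ((h ⟨y, hy⟩ (r / 4) (by positivity) (by linarith)).trans (measure_mono ?_))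
  · apply le_of_eq; congr 1; rw [div_eq_mul_one_div r, mul_pow]; ring
  · intro z hz
    rw [mem_ball, Subtype.dist_eq] at hz
    simp only [mem_ofPred_eq, Subtype.dist_eq] at hye hz ⊢
    have := dist_triangle (z : EuclideanSpace ℝ (Fin d)) y e
    have := dist_triangle y (z : EuclideanSpace ℝ (Fin d)) e
    have := dist_comm y (z : EuclideanSpace ℝ (Fin d))
    constructor <;> linarith

lemma avg_lower (d : ℕ) (hd : 2 ≤ d) : ∃ c : ℝ, 0 < c ∧ ∀ n : ℕ, 20 ≤ n → ∀ t ∈ Icc (1 : ℝ) 2,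
    ∀ x : EuclideanSpace ℝ (Fin d), dist ‖x‖ t < 2 ^ (-(n : ℤ) + 2) →
      ENNReal.ofReal (c * n) ≤ sphAvg d (testFn d n) t x := by
  obtain ⟨K, hK, hann⟩ := annulus_lower d hd
  refine ⟨K * (1 / 8) ^ (d - 1) / 4, by positivity, fun n hn t ht x hx => ?_⟩
  have hη : (2 : ℝ) ^ (-(n : ℤ) + 2) ≤ 1 / 8 := by
    calc (2 : ℝ) ^ (-(n : ℤ) + 2) ≤ (2 : ℝ) ^ (-3 : ℤ) :=
          zpow_le_zpow_right₀ (by norm_num) (by omega)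
      _ = _ := by norm_num
  rw [Real.dist_eq] at hx
  have hx' := abs_lt.1 hx
  have hx0 : 0 < ‖x‖ := by linarith [ht.1]
  let e : sphere (0 : EuclideanSpace ℝ (Fin d)) 1 :=
    ⟨‖x‖⁻¹ • x, by simp [norm_smul, hx0.ne']⟩
  have he : ‖(e : EuclideanSpace ℝ (Fin d))‖ = 1 := by simp
  have hxe : x = ‖x‖ • (e : EuclideanSpace ℝ (Fin d)) := by
    simp [e, smul_smul, hx0.ne']
  let A : ℕ → Set (sphere (0 : EuclideanSpace ℝ (Fin d)) 1) := fun j =>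
    {y | (2 : ℝ)⁻¹ ^ j ≤ dist y e ∧ dist y e < 2 * (2 : ℝ)⁻¹ ^ j}
  have hA : ∀ j, MeasurableSet (A j) := fun j =>
    MeasurableSet.inter (s₁ := {y | (2 : ℝ)⁻¹ ^ j ≤ dist y e})
      (s₂ := {y | dist y e < 2 * (2 : ℝ)⁻¹ ^ j})
      (measurableSet_le measurable_const (measurable_id.dist measurable_const))
      (measurableSet_lt (measurable_id.dist measurable_const) measurable_const)
  have hdisj : ∀ i j, i < j → Disjoint (A i) (A j) := by
    intro i j hij
    rw [Set.disjoint_left]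
    intro y h1 h2
    have : (2 : ℝ)⁻¹ ^ j ≤ (2 : ℝ)⁻¹ ^ (i + 1) :=
      pow_le_pow_of_le_one (by norm_num) (by norm_num) hij
    rw [pow_succ] at this
    linarith [h1.1, h2.2]
  have hpd : (↑(Finset.Icc 4 (n / 2)) : Set ℕ).PairwiseDisjoint A := by
    intro i _ j _ hij
    rcases lt_or_gt_of_ne hij with h | h
    · exact hdisj i j h
    · exact (hdisj j i h).symm
  have hpt : ∀ j ∈ Finset.Icc 4 (n / 2), ∀ y ∈ A j,
      (8 * (2 : ℝ)⁻¹ ^ j) ^ (1 - (d : ℝ)) ≤ |testFn d n (x - t • (y : EuclideanSpace ℝ (Fin d)))| := by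
    intro j hj y hy
    rw [Finset.mem_Icc] at hj
    have hj0 : 0 < (2 : ℝ)⁻¹ ^ j := by positivity
    have hj1 : (2 : ℝ)⁻¹ ^ j ≤ 1 / 16 := by
      calc (2 : ℝ)⁻¹ ^ j ≤ (2 : ℝ)⁻¹ ^ 4 := pow_le_pow_of_le_one (by norm_num) (by norm_num) hj.1
        _ = _ := by norm_num
    have hpj : (2 : ℝ)⁻¹ ^ j = 2 ^ (-(j : ℤ)) := by simp
    have hη2 : (2 : ℝ) ^ (-(n : ℤ) + 2) ≤ (2 : ℝ)⁻¹ ^ j / 2 := by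
      calc (2 : ℝ) ^ (-(n : ℤ) + 2) ≤ (2 : ℝ) ^ (-(j : ℤ) - 1) :=
            zpow_le_zpow_right₀ (by norm_num) (by omega)
        _ = _ := by rw [zpow_sub₀ (by norm_num), hpj]; norm_num
    have hlow : (2 : ℝ) ^ (-(10 * n : ℤ)) ≤ (2 : ℝ)⁻¹ ^ j / 2 := by
      calc (2 : ℝ) ^ (-(10 * n : ℤ)) ≤ (2 : ℝ) ^ (-(j : ℤ) - 1) :=
            zpow_le_zpow_right₀ (by norm_num) (by omega)
        _ = _ := by rw [zpow_sub₀ (by norm_num), hpj]; norm_num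
    have hy1 : (2 : ℝ)⁻¹ ^ j ≤ ‖(e : EuclideanSpace ℝ (Fin d)) - y‖ := by
      rw [← dist_eq_norm, dist_comm]; exact hy.1
    have hy2 : ‖(e : EuclideanSpace ℝ (Fin d)) - y‖ ≤ 2 * (2 : ℝ)⁻¹ ^ j := by
      rw [← dist_eq_norm, dist_comm]; exact hy.2.le
    have hdec : x - t • (y : EuclideanSpace ℝ (Fin d)) =
        (‖x‖ - t) • (e : EuclideanSpace ℝ (Fin d)) + t • ((e : EuclideanSpace ℝ (Fin d)) - y) := by
      rw [sub_smul, smul_sub, ← hxe]; abel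
    have hn1 : ‖(‖x‖ - t) • (e : EuclideanSpace ℝ (Fin d))‖ ≤ (2 : ℝ)⁻¹ ^ j / 2 := by
      rw [norm_smul, he, mul_one, Real.norm_eq_abs]; linarith
    have hn2 : ‖t • ((e : EuclideanSpace ℝ (Fin d)) - y)‖ =
        t * ‖(e : EuclideanSpace ℝ (Fin d)) - y‖ := by
      rw [norm_smul, Real.norm_eq_abs, abs_of_nonneg (by linarith [ht.1])]
    have hup : ‖x - t • (y : EuclideanSpace ℝ (Fin d))‖ ≤ 8 * (2 : ℝ)⁻¹ ^ j := by
      rw [hdec]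
      refine (norm_add_le _ _).trans ?_
      rw [hn2]
      have : t * ‖(e : EuclideanSpace ℝ (Fin d)) - y‖ ≤ 2 * (2 * (2 : ℝ)⁻¹ ^ j) :=
        mul_le_mul ht.2 hy2 (norm_nonneg _) (by norm_num)
      linarith
    have hlo : (2 : ℝ)⁻¹ ^ j / 2 ≤ ‖x - t • (y : EuclideanSpace ℝ (Fin d))‖ := by
      rw [hdec]
      have h3 := norm_sub_le_norm_add (t • ((e : EuclideanSpace ℝ (Fin d)) - y))
        ((‖x‖ - t) • (e : EuclideanSpace ℝ (Fin d)))
      rw [add_comm, hn2] at h3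
      have : 1 * (2 : ℝ)⁻¹ ^ j ≤ t * ‖(e : EuclideanSpace ℝ (Fin d)) - y‖ :=
        mul_le_mul ht.1 hy1 hj0.le (by linarith [ht.1])
      linarith
    refine le_trans ?_ (le_abs_self _)
    rw [testFn, if_pos ⟨by linarith, by linarith⟩]
    refine Real.rpow_le_rpow_of_nonpos (by linarith) hup ?_
    have : (2 : ℝ) ≤ d := by exact_mod_cast hd
    linarith
  rw [sphAvg]
  calc ENNReal.ofReal (K * (1 / 8) ^ (d - 1) / 4 * n)
      ≤ ∑ j ∈ Finset.Icc 4 (n / 2), ENNReal.ofReal (K * (1 / 8) ^ (d - 1)) := by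
        rw [Finset.sum_const, nsmul_eq_mul, Nat.card_Icc, ← ENNReal.ofReal_natCast,
          ← ENNReal.ofReal_mul (by positivity)]
        apply ENNReal.ofReal_le_ofReal
        have h5 : n ≤ 4 * (n / 2 + 1 - 4) := by omega
        have h6 : (n : ℝ) ≤ 4 * ((n / 2 + 1 - 4 : ℕ) : ℝ) := by exact_mod_cast h5
        have h7 : 0 < K * (1 / 8) ^ (d - 1) := by positivity
        nlinarith
    _ ≤ ∑ j ∈ Finset.Icc 4 (n / 2), ∫⁻ y in A j,
        ENNReal.ofReal |testFn d n (x - t • (y : EuclideanSpace ℝ (Fin d)))| ∂(sphMeasure d) := by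
        refine Finset.sum_le_sum fun j hj => ?_
        have hj0 : 0 < (2 : ℝ)⁻¹ ^ j := by positivity
        calc ENNReal.ofReal (K * (1 / 8) ^ (d - 1))
            = ENNReal.ofReal ((8 * (2 : ℝ)⁻¹ ^ j) ^ (1 - (d : ℝ))) *
              ENNReal.ofReal (K * ((2 : ℝ)⁻¹ ^ j) ^ (d - 1)) := by
              rw [← ENNReal.ofReal_mul (by positivity)]
              congr 1
              have : (1 - (d : ℝ)) = -((d - 1 : ℕ) : ℝ) := by
                rw [Nat.cast_sub (by omega)]; simp
              rw [this, Real.rpow_neg (by positivity), Real.rpow_natCast, mul_pow]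
              field_simp
              rw [← mul_pow]; norm_num
          _ ≤ ENNReal.ofReal ((8 * (2 : ℝ)⁻¹ ^ j) ^ (1 - (d : ℝ))) * sphMeasure d (A j) := by
              gcongr
              exact hann e _ hj0 (pow_le_one₀ (by norm_num) (by norm_num))
          _ = ∫⁻ y in A j, ENNReal.ofReal ((8 * (2 : ℝ)⁻¹ ^ j) ^ (1 - (d : ℝ))) ∂(sphMeasure d) := by
              rw [setLIntegral_const]
          _ ≤ _ := setLIntegral_mono' (hA j) fun y hy => ENNReal.ofReal_le_ofReal (hpt j hj y hy)
    _ = ∫⁻ y in ⋃ j ∈ Finset.Icc 4 (n / 2), A j,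
        ENNReal.ofReal |testFn d n (x - t • (y : EuclideanSpace ℝ (Fin d)))| ∂(sphMeasure d) :=
        (lintegral_biUnion_finset hpd (fun j _ => hA j) _).symm
    _ ≤ _ := setLIntegral_le_lintegral _ _

lemma max_lower (d : ℕ) (hd : 2 ≤ d) (E : Set ℝ)
    (hE : E ⊆ Icc (1 : ℝ) 2) (hne : E.Nonempty) :
    ∃ c : ℝ, 0 < c ∧ ∃ N : ℕ, ∀ n : ℕ, N ≤ n →
      ∀ x : EuclideanSpace ℝ (Fin d), Metric.infDist ‖x‖ E ≤ 2 ^ (-(n : ℤ) + 1) →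
        ENNReal.ofReal (c * n) ≤ sphMax d E (testFn d n) x := by
  obtain ⟨c, hc, h⟩ := avg_lower d hd
  refine ⟨c, hc, 20, fun n hn x hx => ?_⟩
  have : (2 : ℝ) ^ (-(n : ℤ) + 1) < 2 ^ (-(n : ℤ) + 2) :=
    zpow_lt_zpow_right₀ (by norm_num) (by omega)
  obtain ⟨t, ht, hxt⟩ := (Metric.infDist_lt_iff hne).1 (hx.trans_lt this)
  exact (h n hn t (hE ht) x hxt).trans (le_iSup₂_of_le t ht le_rfl)

lemma norm_testFn (d : ℕ) (hd : 2 ≤ d) : ∃ L : ℝ, 0 < L ∧ ∀ n : ℕ,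
    lpE (volume : Measure (EuclideanSpace ℝ (Fin d))) ((d : ℝ) / (d - 1))
      (fun x => ENNReal.ofReal (testFn d n x)) =
        ENNReal.ofReal (L * (n : ℝ) ^ ((d - 1 : ℝ) / d)) := by
  obtain ⟨w, hw, hw'⟩ := toSphere_fin d hd
  have hd' : (2 : ℝ) ≤ d := by exact_mod_cast hd
  have hlog : 0 < Real.log 2 := Real.log_pos (by norm_num)
  have hp : 0 ≤ (d : ℝ) / (d - 1) := div_nonneg (by linarith) (by linarith)
  refine ⟨(w * (10 * Real.log 2)) ^ ((d - 1 : ℝ) / d), by positivity, fun n => ?_⟩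
  set a : ℝ := (2 : ℝ) ^ (-(10 * n : ℤ)) with ha
  have ha0 : 0 < a := by positivity
  have ha1 : a ≤ 1 := by
    calc a ≤ (2 : ℝ) ^ (0 : ℤ) := zpow_le_zpow_right₀ (by norm_num) (by omega)
      _ = 1 := by simp
  let g : ℝ → ℝ≥0∞ := fun r => ENNReal.ofReal (if a ≤ r ∧ r ≤ 1 then r ^ (1 - (d : ℝ)) else 0)
    ^ ((d : ℝ) / (d - 1))
  have hset : MeasurableSet {r : ℝ | a ≤ r ∧ r ≤ 1} := measurableSet_Icc
  have hg : Measurable g := by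
    apply Measurable.pow_const
    apply Measurable.ennreal_ofReal
    exact Measurable.ite hset (by fun_prop) (by fun_prop)
  have hint : ∫⁻ x : EuclideanSpace ℝ (Fin d), ENNReal.ofReal (testFn d n x) ^ ((d : ℝ) / (d - 1))
      = ENNReal.ofReal (w * (10 * Real.log 2) * n) := by
    change ∫⁻ x : EuclideanSpace ℝ (Fin d), g ‖x‖ = _
    rw [polar_lintegral d hd g hg, hw']
    have h1 : ∫⁻ r in Ioi (0 : ℝ), ENNReal.ofReal (r ^ (d - 1)) * g r =
        ∫⁻ r in Ioi (0 : ℝ), (Icc a 1).indicator (fun r => ENNReal.ofReal r⁻¹) r := by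
      refine setLIntegral_congr_fun measurableSet_Ioi fun r hr => ?_
      have hr : 0 < r := hr
      by_cases h : a ≤ r ∧ r ≤ 1
      · simp only [g]
        rw [if_pos h, indicator_of_mem (show r ∈ Icc a 1 from h),
          ENNReal.ofReal_rpow_of_pos (by positivity), ← ENNReal.ofReal_mul (by positivity),
          ← Real.rpow_mul hr.le, ← Real.rpow_natCast, ← Real.rpow_add hr, ← Real.rpow_neg_one]
        congr 2
        rw [Nat.cast_sub (by omega)]
        have : (d : ℝ) - 1 ≠ 0 := by linarith
        push_cast
        field_simp
        ring
      · have hp' : 0 < (d : ℝ) / (d - 1) := div_pos (by linarith) (by linarith)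
        simp only [g]
        rw [if_neg h, indicator_of_notMem (show r ∉ Icc a 1 from h)]
        simp [hp']
    rw [h1, lintegral_indicator measurableSet_Icc, Measure.restrict_restrict measurableSet_Icc,
      inter_eq_left.2 (show Icc a 1 ⊆ Ioi 0 from fun r hr => lt_of_lt_of_le ha0 hr.1), ← restrict_Ioc_eq_restrict_Icc,
      ← ofReal_integral_eq_lintegral_ofReal, ← intervalIntegral.integral_of_le ha1,
      integral_inv_of_pos ha0 one_pos, ← ENNReal.ofReal_mul hw.le]
    · congr 1
      rw [one_div, Real.log_inv, ha, Real.log_zpow]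
      push_cast; ring
    · have : IntervalIntegrable (fun r : ℝ => r⁻¹) volume a 1 := by
        apply ContinuousOn.intervalIntegrable
        rw [uIcc_of_le ha1]
        exact continuousOn_inv₀.mono fun r hr => (lt_of_lt_of_le ha0 hr.1).ne'
      exact this.1
    · filter_upwards [ae_restrict_mem measurableSet_Ioc] with r hr
      exact inv_nonneg.2 (ha0.trans hr.1).le
  rw [lpE, hint, one_div_div, ENNReal.ofReal_rpow_of_nonneg (by positivity)
    (div_nonneg (by linarith) (by linarith)), Real.mul_rpow (by positivity) (by positivity)]

lemma Wn_meas (E : Set ℝ) (n : ℕ) : MeasurableSet (Wn E n) :=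
  MeasurableSet.inter (s₁ := {r : ℝ | 0 ≤ r}) (s₂ := {r | Metric.infDist r E ≤ 2 ^ (-(n : ℤ) + 1)})
    (measurableSet_le measurable_const measurable_id)
    (measurableSet_le measurable_infDist measurable_const)

lemma Wn_bounds (E : Set ℝ) (hE : E ⊆ Icc (1 : ℝ) 2) (hne : E.Nonempty) (n : ℕ) (r : ℝ)
    (hr : r ∈ Wn E n) : 1 - 2 ^ (-(n : ℤ) + 1) ≤ r ∧ r ≤ 2 + 2 ^ (-(n : ℤ) + 1) := by
  constructor
  · by_contra! h
    have h2 : Metric.infDist r E < 1 - r := by linarith [hr.2]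
    obtain ⟨t, ht, h3⟩ := (Metric.infDist_lt_iff hne).1 h2
    rw [Real.dist_eq] at h3
    linarith [(abs_lt.1 h3).1, (hE ht).1]
  · by_contra! h
    have h2 : Metric.infDist r E < r - 2 := by linarith [hr.2]
    obtain ⟨t, ht, h3⟩ := (Metric.infDist_lt_iff hne).1 h2
    rw [Real.dist_eq] at h3
    linarith [(abs_lt.1 h3).2, (hE ht).2]

lemma Wn_vol (E : Set ℝ) (hE : E ⊆ Icc (1 : ℝ) 2) (hne : E.Nonempty) (n : ℕ) (hn : 1 ≤ n) :
    volume (Wn E n) ≤ ENNReal.ofReal 4 := by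
  calc volume (Wn E n) ≤ volume (Icc (0 : ℝ) 4) := by
        apply measure_mono
        intro r hr
        have h1 := (Wn_bounds E hE hne n r hr).2
        have : (2 : ℝ) ^ (-(n : ℤ) + 1) ≤ (2 : ℝ) ^ (0 : ℤ) :=
          zpow_le_zpow_right₀ (by norm_num) (by omega)
        simp only [zpow_zero] at this
        exact ⟨hr.1, by linarith⟩
    _ = _ := by rw [Real.volume_Icc]; norm_num

lemma testFn_meas (d n : ℕ) : Measurable (testFn d n) := by
  unfold testFn
  refine Measurable.ite ?_ (by fun_prop) (by fun_prop)
  exact MeasurableSet.inter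
    (s₁ := {x : EuclideanSpace ℝ (Fin d) | (2 : ℝ) ^ (-(10 * n : ℤ)) ≤ ‖x‖}) (s₂ := {x | ‖x‖ ≤ 1})
    (measurableSet_le measurable_const measurable_norm)
    (measurableSet_le measurable_norm measurable_const)

lemma testFn_nonneg (d n : ℕ) (x) : 0 ≤ testFn d n x := by
  unfold testFn
  split_ifs <;> positivity

lemma shell_vol (d : ℕ) (hd : 2 ≤ d) : ∃ k : ℝ, 0 < k ∧ ∀ (E : Set ℝ), E ⊆ Icc (1 : ℝ) 2 →
    E.Nonempty → ∀ n : ℕ, 2 ≤ n → ENNReal.ofReal k * volume (Wn E n) ≤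
      volume {x : EuclideanSpace ℝ (Fin d) | ‖x‖ ∈ Wn E n} := by
  obtain ⟨w, hw, hw'⟩ := toSphere_fin d hd
  refine ⟨w * (1 / 2) ^ (d - 1), by positivity, fun E hE hne n hn => ?_⟩
  have hm : MeasurableSet {x : EuclideanSpace ℝ (Fin d) | ‖x‖ ∈ Wn E n} :=
    measurable_norm (Wn_meas E n)
  have hlow : ∀ r ∈ Wn E n, 1 / 2 ≤ r := fun r hr => by
    have h1 := (Wn_bounds E hE hne n r hr).1
    have : (2 : ℝ) ^ (-(n : ℤ) + 1) ≤ (2 : ℝ) ^ (-1 : ℤ) :=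
      zpow_le_zpow_right₀ (by norm_num) (by omega)
    norm_num at this ⊢
    linarith
  rw [← lintegral_indicator_one hm]
  have h1 := polar_lintegral d hd ((Wn E n).indicator 1) (measurable_one.indicator (Wn_meas E n))
  change _ ≤ ∫⁻ x : EuclideanSpace ℝ (Fin d), (Wn E n).indicator 1 ‖x‖
  rw [h1, hw', ENNReal.ofReal_mul hw.le, mul_assoc]
  gcongr
  calc ENNReal.ofReal ((1 / 2) ^ (d - 1)) * volume (Wn E n)
      = ∫⁻ r in Wn E n, ENNReal.ofReal ((1 / 2) ^ (d - 1)) := by rw [setLIntegral_const]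
    _ ≤ ∫⁻ r in Wn E n, ENNReal.ofReal (r ^ (d - 1)) * (Wn E n).indicator 1 r := by
        refine setLIntegral_mono' (Wn_meas E n) fun r hr => ?_
        rw [indicator_of_mem hr, Pi.one_apply, mul_one]
        apply ENNReal.ofReal_le_ofReal
        exact pow_le_pow_left₀ (by norm_num) (hlow r hr) _
    _ ≤ _ := lintegral_mono_set fun r hr => lt_of_lt_of_le (by norm_num) (hlow r hr)

lemma Wn_decay (d : ℕ) (hd : 2 ≤ d) (E : Set ℝ)
    (hE : E ⊆ Icc (1 : ℝ) 2) (hne : E.Nonempty) (q : ℝ) (hq : 1 ≤ q)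
    (hb : ∃ C : ℝ≥0, ∀ f : EuclideanSpace ℝ (Fin d) → ℝ, Measurable f →
        (∀ x y, ‖x‖ = ‖y‖ → f x = f y) →
        lpE (volume : Measure (EuclideanSpace ℝ (Fin d))) q (sphMax d E f) ≤
          C * lpE (volume : Measure (EuclideanSpace ℝ (Fin d))) ((d : ℝ) / (d - 1))
            (fun x => ENNReal.ofReal |f x|)) :
    ∃ C' : ℝ, 0 < C' ∧ ∀ n : ℕ, 1 ≤ n →
        volume (Wn E n) ≤ ENNReal.ofReal (C' * (n : ℝ) ^ (-(q / d))) := by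
  obtain ⟨C, hC⟩ := hb
  obtain ⟨L, hL, hnorm⟩ := norm_testFn d hd
  obtain ⟨c, hc, N, hmax⟩ := max_lower d hd E hE hne
  obtain ⟨k, hk, hshell⟩ := shell_vol d hd
  have hd' : (2 : ℝ) ≤ d := by exact_mod_cast hd
  have hqd : 0 ≤ q / d := by positivity
  set M : ℝ := N + 2 with hM
  have hM0 : 0 < M := by positivity
  refine ⟨4 * M ^ (q / d) + (C * L / c) ^ q / k, by positivity, fun n hn => ?_⟩
  have hn0 : (0 : ℝ) < n := by exact_mod_cast hn
  by_cases hnN : n < N + 2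
  · refine (Wn_vol E hE hne n hn).trans (ENNReal.ofReal_le_ofReal ?_)
    have h1 : (n : ℝ) ^ (q / d) ≤ M ^ (q / d) := by
      apply Real.rpow_le_rpow hn0.le _ hqd
      rw [hM]; exact_mod_cast hnN.le
    rw [Real.rpow_neg hn0.le, ← div_eq_mul_inv, le_div_iff₀ (by positivity)]
    have : 0 ≤ (C * L / c) ^ q / k := by positivity
    linarith
  · have hfin : volume (Wn E n) ≠ ⊤ := ((Wn_vol E hE hne n hn).trans_lt ENNReal.ofReal_lt_top).ne
    set V := (volume (Wn E n)).toReal with hV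
    have hCn := hC (testFn d n) (testFn_meas d n) (fun x y h => by simp [testFn, h])
    simp only [abs_of_nonneg (testFn_nonneg d n _)] at hCn
    rw [hnorm n, lpE] at hCn
    have hq0 : 0 < q := by linarith
    have h1 : ∫⁻ x, sphMax d E (testFn d n) x ^ q ≤
        ENNReal.ofReal ((C * (L * (n : ℝ) ^ ((d - 1 : ℝ) / d))) ^ q) := by
      rw [one_div, ENNReal.rpow_inv_le_iff hq0] at hCn
      refine hCn.trans (le_of_eq ?_)
      rw [← ENNReal.ofReal_rpow_of_nonneg (by positivity) hq0.le, ENNReal.ofReal_mul C.coe_nonneg, ENNReal.ofReal_coe_nnreal]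
    have h2 : ENNReal.ofReal ((c * n) ^ q) * (ENNReal.ofReal k * volume (Wn E n)) ≤
        ∫⁻ x, sphMax d E (testFn d n) x ^ q := by
      have hm : MeasurableSet {x : EuclideanSpace ℝ (Fin d) | ‖x‖ ∈ Wn E n} :=
        measurable_norm (Wn_meas E n)
      calc _ ≤ ENNReal.ofReal ((c * n) ^ q) *
              volume {x : EuclideanSpace ℝ (Fin d) | ‖x‖ ∈ Wn E n} := by
            gcongr
            exact hshell E hE hne n (by omega)
        _ = ∫⁻ x in {x : EuclideanSpace ℝ (Fin d) | ‖x‖ ∈ Wn E n}, ENNReal.ofReal ((c * n) ^ q) := by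
            rw [setLIntegral_const]
        _ ≤ ∫⁻ x in {x : EuclideanSpace ℝ (Fin d) | ‖x‖ ∈ Wn E n}, sphMax d E (testFn d n) x ^ q := by
            refine setLIntegral_mono' hm fun x hx => ?_
            rw [← ENNReal.ofReal_rpow_of_nonneg (by positivity) hq0.le]
            gcongr
            exact hmax n (by omega) x hx.2
        _ ≤ _ := setLIntegral_le_lintegral _ _
    have h3 := h2.trans h1
    rw [← ENNReal.ofReal_toReal hfin, ← hV, ← ENNReal.ofReal_mul (by positivity),
      ← ENNReal.ofReal_mul (by positivity), ENNReal.ofReal_le_ofReal_iff (by positivity)] at h3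
    rw [← ENNReal.ofReal_toReal hfin, ← hV]
    apply ENNReal.ofReal_le_ofReal
    have h4 : V ≤ (C * L / c) ^ q / k * (n : ℝ) ^ (-(q / d)) := by
      have e1 : (C * (L * (n : ℝ) ^ ((d - 1 : ℝ) / d))) ^ q =
          (C * L) ^ q * ((n : ℝ) ^ q * (n : ℝ) ^ (-(q / d))) := by
        rw [← mul_assoc, Real.mul_rpow (by positivity) (by positivity), ← Real.rpow_mul hn0.le,
          ← Real.rpow_add hn0]
        congr 2
        field_simp
        ring
      rw [e1, Real.mul_rpow hc.le hn0.le] at h3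
      rw [Real.div_rpow (by positivity) hc.le]
      have hcq : 0 < c ^ q := by positivity
      have hnq : 0 < (n : ℝ) ^ q := by positivity
      rw [div_div, div_mul_eq_mul_div, le_div_iff₀ (by positivity)]
      refine le_of_mul_le_mul_right ?_ hnq
      calc _ = c ^ q * (n : ℝ) ^ q * (k * V) := by ring
        _ ≤ _ := h3
        _ = _ := by ring
    have : 0 ≤ 4 * M ^ (q / d) * (n : ℝ) ^ (-(q / d)) := by positivity
    linarith

lemma cover_bound (E : Set ℝ) (hE : E ⊆ Icc (1 : ℝ) 2) (δ : ℝ) (h0 : 0 < δ) (h1 : δ < 1)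
    (n : ℕ) (hn : δ ≤ 2 ^ (-(n : ℤ) + 1)) :
    ENNReal.ofReal (δ * coverNum E δ) ≤ volume (Wn E n) := by
  classical
  let F : Set ℤ := (fun x : ℝ => ⌊x / δ⌋) '' E
  have hF : F.Finite := by
    refine (Set.finite_Icc (⌊1 / δ⌋) (⌊2 / δ⌋)).subset ?_
    rintro _ ⟨x, hx, rfl⟩
    have := hE hx
    constructor <;> apply Int.floor_le_floor <;> gcongr
    exacts [this.1, this.2]
  let s : Finset ℤ := hF.toFinset
  let cell : ℤ → Set ℝ := fun k => Ico (k * δ) (k * δ + δ)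
  have hcell : ∀ x : ℝ, x ∈ cell ⌊x / δ⌋ := fun x => by
    have h2 := Int.floor_le (x / δ)
    have h3 := Int.lt_floor_add_one (x / δ)
    rw [le_div_iff₀ h0] at h2
    rw [div_lt_iff₀ h0] at h3
    exact ⟨h2, by linarith⟩
  have hcov : coverNum E δ ≤ s.card := by
    refine le_trans (Nat.sInf_le ⟨s.image (fun k : ℤ => (k : ℝ) * δ), rfl, ?_⟩) Finset.card_image_le
    intro x hx
    simp only [Finset.mem_image, iUnion_exists, mem_iUnion]
    refine ⟨⌊x / δ⌋ * δ, ⌊x / δ⌋, ⟨hF.mem_toFinset.2 ⟨x, hx, rfl⟩, rfl⟩, Ico_subset_Icc_self (hcell x)⟩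
  have hdisj : (↑s : Set ℤ).PairwiseDisjoint cell := by
    have key : ∀ i j : ℤ, i < j → Disjoint (cell i) (cell j) := by
      intro i j hij
      rw [Set.disjoint_left]
      intro x hx hy
      have : ((i : ℝ) + 1) ≤ j := by exact_mod_cast hij
      have := mul_le_mul_of_nonneg_right this h0.le
      linarith [hx.2, hy.1]
    intro i _ j _ hij
    rcases lt_or_gt_of_ne hij with h | h
    · exact key i j h
    · exact (key j i h).symm
  calc ENNReal.ofReal (δ * coverNum E δ) ≤ ENNReal.ofReal (δ * s.card) := by gcongr
    _ = ∑ k ∈ s, volume (cell k) := by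
        simp only [cell, Real.volume_Ico, add_sub_cancel_left, Finset.sum_const, nsmul_eq_mul]
        rw [ENNReal.ofReal_mul h0.le, mul_comm, ENNReal.ofReal_natCast]
    _ = volume (⋃ k ∈ s, cell k) :=
        (measure_biUnion_finset hdisj fun k _ => measurableSet_Ico).symm
    _ ≤ _ := by
        apply measure_mono
        refine iUnion₂_subset fun k hk => ?_
        obtain ⟨x, hx, rfl⟩ := hF.mem_toFinset.1 hk
        intro r hr
        have h2 := hcell x
        have h3 := (hE hx).1
        have hrx : dist r x ≤ δ := by
          rw [Real.dist_eq, abs_le]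
          constructor <;> linarith [hr.1, hr.2, h2.1, h2.2]
        refine ⟨?_, (Metric.infDist_le_dist_of_mem hx).trans (hrx.trans hn)⟩
        linarith [hr.1, hr.2, h2.1, h2.2]


theorem log_endpoint_necessary (d : ℕ) (hd : 2 ≤ d) (E : Set ℝ)
    (hE : E ⊆ Icc (1 : ℝ) 2) (hne : E.Nonempty) :
    (∃ c₁ c₂ : ℝ, 0 < c₁ ∧ 0 < c₂ ∧ ∃ N : ℕ, ∀ n : ℕ, N ≤ n →
      ENNReal.ofReal (c₁ * (n : ℝ) ^ ((d - 1 : ℝ) / d)) ≤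
          lpE (volume : Measure (EuclideanSpace ℝ (Fin d))) ((d : ℝ) / (d - 1))
            (fun x => ENNReal.ofReal (testFn d n x)) ∧
        lpE (volume : Measure (EuclideanSpace ℝ (Fin d))) ((d : ℝ) / (d - 1))
            (fun x => ENNReal.ofReal (testFn d n x)) ≤
          ENNReal.ofReal (c₂ * (n : ℝ) ^ ((d - 1 : ℝ) / d))) ∧
    (∃ c : ℝ, 0 < c ∧ ∃ N : ℕ, ∀ n : ℕ, N ≤ n →
      ∀ x : EuclideanSpace ℝ (Fin d), Metric.infDist ‖x‖ E ≤ 2 ^ (-(n : ℤ) + 1) →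
        ENNReal.ofReal (c * n) ≤ sphMax d E (testFn d n) x) ∧
    (∀ q : ℝ, 1 ≤ q →
      (∃ C : ℝ≥0, ∀ f : EuclideanSpace ℝ (Fin d) → ℝ, Measurable f →
        (∀ x y, ‖x‖ = ‖y‖ → f x = f y) →
        lpE (volume : Measure (EuclideanSpace ℝ (Fin d))) q (sphMax d E f) ≤
          C * lpE (volume : Measure (EuclideanSpace ℝ (Fin d))) ((d : ℝ) / (d - 1))
            (fun x => ENNReal.ofReal |f x|)) →
      (∃ C' : ℝ, 0 < C' ∧ ∀ n : ℕ, 1 ≤ n →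
        volume (Wn E n) ≤ ENNReal.ofReal (C' * (n : ℝ) ^ (-(q / d)))) ∧
      (∃ C'' : ℝ, ∀ δ ∈ Ioo (0 : ℝ) 1,
        Real.log (1 / δ) ^ (q / d) * δ * (coverNum E δ : ℝ) ≤ C'')) := by
  refine ⟨?_, max_lower d hd E hE hne, fun q hq hb => ?_⟩
  · obtain ⟨L, hL, h⟩ := norm_testFn d hd
    exact ⟨L, L, hL, hL, 0, fun n _ => ⟨(h n).ge, (h n).le⟩⟩
  · obtain ⟨C', hC', hW⟩ := Wn_decay d hd E hE hne q hq hb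
    refine ⟨⟨C', hC', hW⟩, C', fun δ hδ => ?_⟩
    obtain ⟨m, hm1, hm2⟩ := exists_nat_pow_near_of_lt_one hδ.1 hδ.2.le
      (show (0 : ℝ) < 2⁻¹ by norm_num) (by norm_num)
    have hn : δ ≤ 2 ^ (-((m + 1 : ℕ) : ℤ) + 1) := by
      refine hm2.trans (le_of_eq ?_)
      push_cast
      simp
    have h1 := (cover_bound E hE δ hδ.1 hδ.2 (m + 1) hn).trans (hW (m + 1) (by omega))
    rw [ENNReal.ofReal_le_ofReal_iff (by positivity)] at h1
    have hlog0 : 0 < Real.log (1 / δ) := Real.log_pos (by rw [lt_div_iff₀ hδ.1]; linarith [hδ.2])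
    have hlog : Real.log (1 / δ) ≤ ((m + 1 : ℕ) : ℝ) := by
      have h2 : Real.log (2⁻¹ ^ (m + 1)) ≤ Real.log δ := Real.log_le_log (by positivity) hm1.le
      rw [Real.log_pow, Real.log_inv] at h2
      rw [one_div, Real.log_inv]
      have h3 : Real.log 2 ≤ 1 := by linarith [Real.log_two_lt_d9]
      have h4 : (0 : ℝ) ≤ ((m + 1 : ℕ) : ℝ) := by positivity
      nlinarith
    have hqd : 0 ≤ q / d := by positivity
    have hm0 : (0 : ℝ) < ((m + 1 : ℕ) : ℝ) := by positivity
    calc Real.log (1 / δ) ^ (q / d) * δ * (coverNum E δ : ℝ)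
        = Real.log (1 / δ) ^ (q / d) * (δ * (coverNum E δ : ℝ)) := by ring
      _ ≤ ((m + 1 : ℕ) : ℝ) ^ (q / d) * (C' * ((m + 1 : ℕ) : ℝ) ^ (-(q / d))) := by
          have := hδ.1
          gcongr
      _ = C' := by
          rw [Real.rpow_neg hm0.le]
          have : 0 < ((m + 1 : ℕ) : ℝ) ^ (q / d) := by positivity
          field_simp
end
end
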